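/- Let $\pi$ be a symmetric probability distribution on $\mathbb{Z}$ with variance $\sigma^2 > 0$ and finite exponential moments near zero, and let $\lambda_N$ denote the top eigenvalue of the operator on $\ell^2(\mathbb{Z})$ with kernel $T_N(s,s') = e^{-(s^2+s'^2)/(2N)}\pi(s-s')$. Then there exists a constant $c > 0$ such that $1 - c N^{-1/2} \leq \lambda_N < 1$ for all $N \geq 1$. -/

import Mathlib

open scoped BigOperators

/-- First and second moments: the averaged parabola. -/
theorem sos_parabola_hasSum (π : ℤ → ℝ)
    (hπnn : ∀ η, 0 ≤ π η) (hπsym : ∀ η, π (-η) = π η)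
    (hπsummable : Summable π) (hπ1 : ∑' η, π η = 1)
    (σ2 : ℝ) (hσ2 : σ2 = ∑' η : ℤ, (η : ℝ)^2 * π η) (hσ2pos : 0 < σ2)
    (R : ℝ) (s : ℤ) :
    HasSum (fun s' : ℤ => π (s - s') * (R - (s' : ℝ)^2)) (R - (s : ℝ)^2 - σ2) := by
  have h2 : Summable fun η : ℤ => (η : ℝ)^2 * π η := by
    by_contra hn
    rw [tsum_eq_zero_of_not_summable hn] at hσ2
    linarith
  have h1 : Summable fun η : ℤ => (η : ℝ) * π η := by
    refine Summable.of_norm_bounded h2 (fun η => ?_)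
    rw [norm_mul, Real.norm_eq_abs, Real.norm_eq_abs, abs_of_nonneg (hπnn η)]
    refine mul_le_mul_of_nonneg_right ?_ (hπnn η)
    have : |η| ≤ η ^ 2 := by
      rw [← sq_abs]
      nlinarith [abs_nonneg η, sq_nonneg (|η| - 1), Int.le_self_sq |η|]
    exact_mod_cast this
  have h10 : ∑' η : ℤ, (η : ℝ) * π η = 0 := by
    have := (Equiv.neg ℤ).tsum_eq (fun η : ℤ => (η : ℝ) * π η)
    simp only [Equiv.neg_apply, hπsym, Int.cast_neg, neg_mul, tsum_neg] at this
    linarith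
  have H0 : HasSum π 1 := hπ1 ▸ hπsummable.hasSum
  have H1 : HasSum (fun η : ℤ => (η : ℝ) * π η) 0 := h10 ▸ h1.hasSum
  have H2 : HasSum (fun η : ℤ => (η : ℝ)^2 * π η) σ2 := hσ2 ▸ h2.hasSum
  have H := ((H0.mul_left (R - (s : ℝ)^2)).add (H1.mul_left (2 * (s : ℝ)))).sub H2
  rw [← (Equiv.subLeft s).hasSum_iff] at H
  have e1 : (fun s' : ℤ => π (s - s') * (R - (s' : ℝ)^2)) =
      (fun b : ℤ => (R - (s:ℝ)^2) * π b + 2 * (s:ℝ) * ((b:ℝ) * π b) - (b:ℝ)^2 * π b) ∘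
        (Equiv.subLeft s) := by
    funext s'
    simp only [Function.comp, Equiv.subLeft_apply]
    push_cast
    ring
  have e2 : R - (s : ℝ)^2 - σ2 = (R - (s:ℝ)^2) * 1 + 2 * (s:ℝ) * 0 - σ2 := by ring
  rw [e1, e2]
  exact H

/-- Upper bound. -/
theorem sos_upper (π : ℤ → ℝ)
    (hπnn : ∀ η, 0 ≤ π η)
    (hπsummable : Summable π) (hπ1 : ∑' η, π η = 1)
    (hπ0 : ∃ η, η ≠ 0 ∧ π η ≠ 0) (N : ℕ) (hN : 1 ≤ N) (l : ℝ)
    (h : ℤ → ℝ) (hpos : ∀ s, 0 < h s) (hs : Summable fun s => (h s)^2)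
    (he : ∀ s : ℤ, ∑' s' : ℤ, Real.exp (-(((s : ℝ)^2 + (s' : ℝ)^2)) / (2 * N)) * π (s - s') * h s'
      = l * h s) : l < 1 := by
  -- maximum
  obtain ⟨m, hm⟩ : ∃ m, ∀ s, h s ≤ h m := by
    have ht := hs.tendsto_cofinite_zero
    have hev := ht.eventually (gt_mem_nhds (show (0:ℝ) < (h 0)^2 from pow_pos (hpos 0) 2))
    have hfin : {s | ¬ (h s)^2 < (h 0)^2}.Finite := Filter.eventually_cofinite.1 hev
    obtain ⟨m, hmS, hm⟩ := Set.exists_max_image _ h hfin ⟨0, by simp⟩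
    refine ⟨m, fun s => ?_⟩
    by_cases hc : (h s)^2 < (h 0)^2
    · have a1 : h s < h 0 := lt_of_pow_lt_pow_left₀ 2 (hpos 0).le hc
      exact a1.le.trans (hm 0 (by simp))
    · exact hm s hc
  obtain ⟨η, hη, hπη⟩ := hπ0
  have hNpos : (0:ℝ) < N := by exact_mod_cast hN
  have hS : HasSum (fun s' : ℤ => π (m - s') * h m) (h m) := by
    have H0 : HasSum π 1 := hπ1 ▸ hπsummable.hasSum
    rw [← (Equiv.subLeft m).hasSum_iff] at H0
    simpa [Function.comp_def] using H0.mul_right (h m)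
  have hexp : ∀ s' : ℤ, Real.exp (-(((m : ℝ)^2 + (s' : ℝ)^2)) / (2 * N)) ≤ 1 := fun s' => by
    rw [Real.exp_le_one_iff]
    apply div_nonpos_of_nonpos_of_nonneg
    · nlinarith [sq_nonneg (m:ℝ), sq_nonneg (s':ℝ)]
    · positivity
  have hle : ∀ s' : ℤ, Real.exp (-(((m : ℝ)^2 + (s' : ℝ)^2)) / (2 * N)) * π (m - s') * h s'
      ≤ π (m - s') * h m := fun s' => by
    refine mul_le_mul ?_ (hm s') (hpos s').le (hπnn _)
    exact mul_le_of_le_one_left (hπnn _) (hexp s')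
  have hsum : Summable fun s' : ℤ =>
      Real.exp (-(((m : ℝ)^2 + (s' : ℝ)^2)) / (2 * N)) * π (m - s') * h s' :=
    Summable.of_nonneg_of_le (fun s' => by have := hπnn (m - s'); have := hpos s'; positivity)
      hle hS.summable
  have hlt : Real.exp (-(((m : ℝ)^2 + ((m - η : ℤ) : ℝ)^2)) / (2 * N)) * π (m - (m - η)) * h (m - η)
      < π (m - (m - η)) * h m := by
    have hp : 0 < π (m - (m - η)) := by
      rw [sub_sub_cancel]; exact lt_of_le_of_ne (hπnn η) (Ne.symm hπη)
    refine mul_lt_mul ?_ (hm _) (hpos _) hp.le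
    refine mul_lt_of_lt_one_left hp ?_
    rw [Real.exp_lt_one_iff]
    apply div_neg_of_neg_of_pos _ (by positivity)
    have hη' : (0:ℝ) < (η:ℝ)^2 := by positivity
    push_cast
    nlinarith [sq_nonneg (2 * (m:ℝ) - η)]
  have hfinal := Summable.tsum_lt_tsum hle hlt hsum hS.summable
  rw [he m, hS.tsum_eq] at hfinal
  by_contra hc
  nlinarith [hpos m]

/-- The mass estimates for the truncated parabola. -/
theorem sos_mass (M : ℕ) (hM : 1 ≤ M) :
    (M:ℝ)^2 * ∑ s ∈ Finset.Icc (-(M:ℤ)) M, ((M:ℝ)^2 - (s:ℝ)^2)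
      ≤ 6 * ∑ s ∈ Finset.Icc (-(M:ℤ)) M, ((M:ℝ)^2 - (s:ℝ)^2)^2 := by
  have hM1 : (1:ℝ) ≤ M := by exact_mod_cast hM
  have hU : ∑ s ∈ Finset.Icc (-(M:ℤ)) M, ((M:ℝ)^2 - (s:ℝ)^2) ≤ 3 * (M:ℝ)^3 := by
    calc _ ≤ ∑ s ∈ Finset.Icc (-(M:ℤ)) M, (M:ℝ)^2 :=
          Finset.sum_le_sum fun s _ => by nlinarith [sq_nonneg (s:ℝ)]
      _ = (2 * M + 1) * (M:ℝ)^2 := by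
          rw [Finset.sum_const, Int.card_Icc, nsmul_eq_mul]
          congr 1
          have : ((M:ℤ) + 1 - -(M:ℤ)).toNat = 2 * M + 1 := by omega
          rw [this]; push_cast; ring
      _ ≤ _ := by nlinarith [sq_nonneg (M:ℝ)]
  have hL : 9/16 * (M:ℝ)^5 ≤ ∑ s ∈ Finset.Icc (-(M:ℤ)) M, ((M:ℝ)^2 - (s:ℝ)^2)^2 := by
    calc 9/16 * (M:ℝ)^5 = M * (9/16 * (M:ℝ)^4) := by ring
      _ ≤ ((Finset.Icc (-((M/2 : ℕ):ℤ)) (M/2 : ℕ)).card : ℝ) * (9/16 * (M:ℝ)^4) := by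
          refine mul_le_mul_of_nonneg_right ?_ (by positivity)
          rw [Int.card_Icc]
          have : M ≤ (((M/2 : ℕ):ℤ) + 1 - -((M/2 : ℕ):ℤ)).toNat := by omega
          exact_mod_cast this
      _ = ∑ s ∈ Finset.Icc (-((M/2 : ℕ):ℤ)) (M/2 : ℕ), (9/16 * (M:ℝ)^4) := by
          rw [Finset.sum_const, nsmul_eq_mul]
      _ ≤ ∑ s ∈ Finset.Icc (-((M/2 : ℕ):ℤ)) (M/2 : ℕ), ((M:ℝ)^2 - (s:ℝ)^2)^2 := by
          refine Finset.sum_le_sum fun s hs => ?_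
          rw [Finset.mem_Icc] at hs
          have a1 : -(M:ℝ) ≤ 2 * s := by
            have : -(M:ℤ) ≤ 2 * s := by omega
            exact_mod_cast this
          have a2 : 2 * (s:ℝ) ≤ M := by
            have : 2 * s ≤ (M:ℤ) := by omega
            exact_mod_cast this
          have a3 : (s:ℝ)^2 ≤ (M:ℝ)^2 / 4 := by nlinarith
          have a4 : 3/4 * (M:ℝ)^2 ≤ (M:ℝ)^2 - (s:ℝ)^2 := by linarith
          calc 9/16 * (M:ℝ)^4 = (3/4 * (M:ℝ)^2)^2 := by ring
            _ ≤ _ := pow_le_pow_left₀ (by positivity) a4 2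
      _ ≤ _ := by
          refine Finset.sum_le_sum_of_subset_of_nonneg ?_ (fun _ _ _ => sq_nonneg _)
          apply Finset.Icc_subset_Icc <;> omega
  have h5 : 0 ≤ (M:ℝ)^5 := by positivity
  calc _ ≤ (M:ℝ)^2 * (3 * (M:ℝ)^3) := by gcongr
    _ = 3 * (M:ℝ)^5 := by ring
    _ ≤ _ := by linarith

/-- The quadratic form of `π` on the truncated parabola. -/
theorem sos_form (π : ℤ → ℝ)
    (hπnn : ∀ η, 0 ≤ π η) (hπsym : ∀ η, π (-η) = π η)
    (hπsummable : Summable π) (hπ1 : ∑' η, π η = 1)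
    (σ2 : ℝ) (hσ2 : σ2 = ∑' η : ℤ, (η : ℝ)^2 * π η) (hσ2pos : 0 < σ2)
    (M : ℕ) (hM : 1 ≤ M) :
    (1 - 6 * σ2 / (M:ℝ)^2) * ∑ s ∈ Finset.Icc (-(M:ℤ)) M, ((M:ℝ)^2 - (s:ℝ)^2)^2
    ≤ ∑ s ∈ Finset.Icc (-(M:ℤ)) M, ∑ s' ∈ Finset.Icc (-(M:ℤ)) M,
        π (s - s') * ((M:ℝ)^2 - (s:ℝ)^2) * ((M:ℝ)^2 - (s':ℝ)^2) := by
  have hM1 : (1:ℝ) ≤ M := by exact_mod_cast hM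
  have hin : ∀ s ∈ Finset.Icc (-(M:ℤ)) M, 0 ≤ (M:ℝ)^2 - (s:ℝ)^2 := fun s hs => by
    rw [Finset.mem_Icc] at hs
    have a1 : -(M:ℝ) ≤ s := by exact_mod_cast hs.1
    have a2 : (s:ℝ) ≤ M := by exact_mod_cast hs.2
    nlinarith
  have hout : ∀ s ∉ Finset.Icc (-(M:ℤ)) M, (M:ℝ)^2 - (s:ℝ)^2 ≤ 0 := fun s hs => by
    rw [Finset.mem_Icc, not_and_or, not_le, not_le] at hs
    rcases hs with hs | hs
    · have a1 : (s:ℝ) < -(M:ℝ) := by exact_mod_cast hs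
      nlinarith
    · have a1 : (M:ℝ) < s := by exact_mod_cast hs
      nlinarith
  have key : ∀ s : ℤ, (M:ℝ)^2 - (s:ℝ)^2 - σ2 ≤
      ∑ s' ∈ Finset.Icc (-(M:ℤ)) M, π (s - s') * ((M:ℝ)^2 - (s':ℝ)^2) := fun s => by
    have H := (sos_parabola_hasSum π hπnn hπsym hπsummable hπ1 σ2 hσ2 hσ2pos ((M:ℝ)^2) s).neg
    have := sum_le_hasSum (Finset.Icc (-(M:ℤ)) M) (fun s' hs' => by
      have := mul_nonneg (hπnn (s - s')) (neg_nonneg.2 (hout s' hs'))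
      linarith) H
    rw [Finset.sum_neg_distrib] at this
    linarith
  have hmass := sos_mass M hM
  set S1 := ∑ s ∈ Finset.Icc (-(M:ℤ)) M, ((M:ℝ)^2 - (s:ℝ)^2)
  set S2 := ∑ s ∈ Finset.Icc (-(M:ℤ)) M, ((M:ℝ)^2 - (s:ℝ)^2)^2 with hS2
  have hS1 : S1 ≤ 6 * S2 / (M:ℝ)^2 := by
    rw [le_div_iff₀ (by positivity)]; linarith
  calc (1 - 6 * σ2 / (M:ℝ)^2) * S2 = S2 - σ2 * (6 * S2 / (M:ℝ)^2) := by ring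
    _ ≤ S2 - σ2 * S1 := by nlinarith
    _ = ∑ s ∈ Finset.Icc (-(M:ℤ)) M,
          ((M:ℝ)^2 - (s:ℝ)^2) * ((M:ℝ)^2 - (s:ℝ)^2 - σ2) := by
        rw [hS2, Finset.mul_sum, ← Finset.sum_sub_distrib]
        exact Finset.sum_congr rfl fun s _ => by ring
    _ ≤ _ := by
        refine Finset.sum_le_sum fun s hs => ?_
        refine (mul_le_mul_of_nonneg_left (key s) (hin s hs)).trans (le_of_eq ?_)
        rw [Finset.mul_sum]
        exact Finset.sum_congr rfl fun s' _ => by ring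

/-- Lower bound for one `N`. -/
theorem sos_lower (π : ℤ → ℝ)
    (hπnn : ∀ η, 0 ≤ π η) (hπsym : ∀ η, π (-η) = π η)
    (hπsummable : Summable π) (hπ1 : ∑' η, π η = 1)
    (σ2 : ℝ) (hσ2 : σ2 = ∑' η : ℤ, (η : ℝ)^2 * π η) (hσ2pos : 0 < σ2)
    (N M : ℕ) (hM : 1 ≤ M) (hMN : M^4 ≤ N) (l : ℝ)
    (hsup : ∀ h : ℤ → ℝ, (Summable fun s => (h s)^2) →
      (∑' s, (h s)^2 = 1) →
      ∑' p : ℤ × ℤ, Real.exp (-(((p.1 : ℝ)^2 + (p.2 : ℝ)^2)) / (2 * N)) * π (p.1 - p.2)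
        * h p.1 * h p.2 ≤ l) :
    1 - (1 + 6 * σ2) / (M:ℝ)^2 ≤ l := by
  have hM1 : (1:ℝ) ≤ M := by exact_mod_cast hM
  have hMN' : (M:ℝ)^4 ≤ N := by exact_mod_cast hMN
  have hNpos : (0:ℝ) < N := lt_of_lt_of_le (by positivity) hMN'
  have hsq : ∀ s ∈ Finset.Icc (-(M:ℤ)) M, (s:ℝ)^2 ≤ (M:ℝ)^2 := fun s hs => by
    rw [Finset.mem_Icc] at hs
    have a1 : -(M:ℝ) ≤ s := by exact_mod_cast hs.1
    have a2 : (s:ℝ) ≤ M := by exact_mod_cast hs.2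
    nlinarith
  have hform := sos_form π hπnn hπsym hπsummable hπ1 σ2 hσ2 hσ2pos M hM
  set S := Finset.Icc (-(M:ℤ)) M with hS
  set S2 := ∑ s ∈ S, ((M:ℝ)^2 - (s:ℝ)^2)^2 with hS2
  have hS2pos : 0 < S2 := by
    refine Finset.sum_pos' (fun _ _ => sq_nonneg _) ⟨0, by simp [hS], ?_⟩
    have h0 : (0:ℝ) < (M:ℝ)^2 := by positivity
    have h1 : ((M:ℝ)^2 - ((0:ℤ):ℝ)^2) = (M:ℝ)^2 := by simp
    rw [h1]
    positivity
  set Z := Real.sqrt S2 with hZ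
  have hZpos : 0 < Z := Real.sqrt_pos.2 hS2pos
  have hZ2 : Z^2 = S2 := Real.sq_sqrt hS2pos.le
  let h : ℤ → ℝ := fun s => if s ∈ S then ((M:ℝ)^2 - (s:ℝ)^2) / Z else 0
  have hin : ∀ s ∈ S, h s = ((M:ℝ)^2 - (s:ℝ)^2) / Z := fun s hs => if_pos hs
  have hout : ∀ s ∉ S, h s = 0 := fun s hs => if_neg hs
  have H2 : HasSum (fun s => (h s)^2) 1 := by
    have e : ∑ s ∈ S, (h s)^2 = 1 := by
      rw [Finset.sum_congr rfl (fun s hs => by rw [hin s hs, div_pow]), ← Finset.sum_div, hZ2]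
      exact div_self hS2pos.ne'
    rw [← e]
    exact hasSum_sum_of_ne_finset_zero fun s hs => by rw [hout s hs]; norm_num
  have hl := hsup h H2.summable H2.tsum_eq
  rw [tsum_eq_sum (s := S ×ˢ S) (fun p hp => by
    rw [Finset.mem_product, not_and_or] at hp
    rcases hp with hp | hp <;> rw [hout _ hp] <;> simp), Finset.sum_product] at hl
  have hx : (M:ℝ)^2 / N ≤ 1 / (M:ℝ)^2 := by
    rw [div_le_div_iff₀ hNpos (by positivity)]
    nlinarith
  have hx1 : 1 / (M:ℝ)^2 ≤ 1 := by
    rw [div_le_one (by positivity)]; nlinarith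
  have hlow : (1 - 1 / (M:ℝ)^2) * (∑ s ∈ S, ∑ s' ∈ S,
        π (s - s') * ((M:ℝ)^2 - (s:ℝ)^2) * ((M:ℝ)^2 - (s':ℝ)^2)) / S2 ≤ l := by
    refine le_trans ?_ hl
    rw [mul_div_assoc, Finset.sum_div, Finset.mul_sum]
    refine Finset.sum_le_sum fun s hs => ?_
    rw [Finset.sum_div, Finset.mul_sum]
    refine Finset.sum_le_sum fun s' hs' => ?_
    rw [hin s hs, hin s' hs', ← hZ2]
    have b1 := hsq s hs
    have b2 := hsq s' hs'
    have hE : 1 - 1 / (M:ℝ)^2 ≤ Real.exp (-(((s : ℝ)^2 + (s' : ℝ)^2)) / (2 * N)) := by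
      have c1 := Real.add_one_le_exp (-(((s : ℝ)^2 + (s' : ℝ)^2)) / (2 * N))
      have c2 : ((s : ℝ)^2 + (s' : ℝ)^2) / (2 * N) ≤ (M:ℝ)^2 / N := by
        rw [div_le_div_iff₀ (by positivity) hNpos]
        nlinarith
      rw [neg_div] at c1 ⊢
      linarith
    have hP : 0 ≤ π (s - s') * ((M:ℝ)^2 - (s:ℝ)^2) * ((M:ℝ)^2 - (s':ℝ)^2) / Z^2 := by
      have := hπnn (s - s')
      have d1 : 0 ≤ (M:ℝ)^2 - (s:ℝ)^2 := by linarith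
      have d2 : 0 ≤ (M:ℝ)^2 - (s':ℝ)^2 := by linarith
      positivity
    refine (mul_le_mul_of_nonneg_right hE hP).trans (le_of_eq ?_)
    field_simp
  refine le_trans ?_ hlow
  rw [le_div_iff₀ hS2pos]
  have f1 := mul_le_mul_of_nonneg_left hform (sub_nonneg.2 hx1)
  refine le_trans ?_ f1
  have f2 : 0 ≤ 1 / (M:ℝ)^2 * (6 * σ2 / (M:ℝ)^2) * S2 := by positivity
  have f3 : (1 - 1 / (M:ℝ)^2) * ((1 - 6 * σ2 / (M:ℝ)^2) * S2)
      = (1 - (1 + 6 * σ2) / (M:ℝ)^2) * S2 + 1 / (M:ℝ)^2 * (6 * σ2 / (M:ℝ)^2) * S2 := by ring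
  linarith

/-- The top eigenvalue `λ_N` of the kernel
`T_N(s,s') = exp(-(s²+s'²)/(2N)) π(s-s')` satisfies
`1 - c N^{-1/2} ≤ λ_N < 1` for some constant `c > 0` and all `N ≥ 1`. -/
theorem interface_SOS_eigenvalue_estimates
    (π : ℤ → ℝ) (a₀ : ℝ) (ha₀ : 0 < a₀)
    (hπnn : ∀ η, 0 ≤ π η) (hπsym : ∀ η, π (-η) = π η)
    (hπsummable : Summable π) (hπ1 : ∑' η, π η = 1)
    (hπexp : ∀ a : ℝ, |a| ≤ a₀ → Summable fun η : ℤ => Real.exp (a * η) * π η)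
    (σ2 : ℝ) (hσ2 : σ2 = ∑' η : ℤ, (η : ℝ)^2 * π η) (hσ2pos : 0 < σ2)
    (T : ℕ → ℤ → ℤ → ℝ)
    (hT : ∀ (N : ℕ) (s s' : ℤ), T N s s' =
      Real.exp (-(((s : ℝ)^2 + (s' : ℝ)^2)) / (2 * N)) * π (s - s'))
    (lam : ℕ → ℝ)
    -- `lam N` is the top eigenvalue: attained by a positive normalized eigenfunction
    (heig : ∀ N, 1 ≤ N → ∃ h : ℤ → ℝ, (∀ s, 0 < h s) ∧
      (Summable fun s => (h s)^2) ∧ (∑' s, (h s)^2 = 1) ∧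
      ∀ s, ∑' s', T N s s' * h s' = lam N * h s)
    -- and it dominates the Rayleigh quotient of every normalized `h`
    (hsup : ∀ N, 1 ≤ N → ∀ h : ℤ → ℝ, (Summable fun s => (h s)^2) →
      (∑' s, (h s)^2 = 1) →
      ∑' p : ℤ × ℤ, T N p.1 p.2 * h p.1 * h p.2 ≤ lam N) :
    ∃ c > 0, ∀ N : ℕ, 1 ≤ N →
      1 - c / Real.sqrt N ≤ lam N ∧ lam N < 1 := by
  refine ⟨4 * (1 + 6 * σ2), by positivity, fun N hN => ⟨?_, ?_⟩⟩
  · obtain ⟨M, hM, h1, h2⟩ : ∃ M : ℕ, 1 ≤ M ∧ M^4 ≤ N ∧ N ≤ (4 * M^2)^2 := by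
      refine ⟨Nat.sqrt (Nat.sqrt N), ?_, ?_, ?_⟩
      · rw [Nat.le_sqrt, Nat.le_sqrt]; simpa using hN
      · have a1 := Nat.sqrt_le' N
        have a2 := Nat.sqrt_le' (Nat.sqrt N)
        calc _ = ((Nat.sqrt (Nat.sqrt N))^2)^2 := by ring
          _ ≤ (Nat.sqrt N)^2 := Nat.pow_le_pow_left a2 2
          _ ≤ N := a1
      · have a1 := Nat.lt_succ_sqrt' N
        have a2 := Nat.lt_succ_sqrt' (Nat.sqrt N)
        have a3 : 1 ≤ Nat.sqrt (Nat.sqrt N) := by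
          rw [Nat.le_sqrt, Nat.le_sqrt]; simpa using hN
        refine a1.le.trans (Nat.pow_le_pow_left ?_ 2)
        refine (Nat.succ_le_of_lt a2).trans ?_
        rw [Nat.succ_eq_add_one]
        nlinarith
    have hl := sos_lower π hπnn hπsym hπsummable hπ1 σ2 hσ2 hσ2pos N M hM h1 (lam N)
      (fun h ha hb => by simpa only [hT] using hsup N hN h ha hb)
    refine le_trans ?_ hl
    have hNpos : (0:ℝ) < N := by exact_mod_cast hN
    have hM1 : (1:ℝ) ≤ M := by exact_mod_cast hM
    have h3 : Real.sqrt N ≤ 4 * (M:ℝ)^2 := by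
      rw [Real.sqrt_le_left (by positivity)]
      exact_mod_cast h2
    have hs : 0 < Real.sqrt N := Real.sqrt_pos.2 hNpos
    have : (1 + 6 * σ2) / (M:ℝ)^2 ≤ 4 * (1 + 6 * σ2) / Real.sqrt N := by
      rw [div_le_div_iff₀ (by positivity) hs]
      nlinarith
    linarith
  · obtain ⟨h, hpos, hs, -, he⟩ := heig N hN
    refine sos_upper π hπnn hπsummable hπ1 ?_ N hN (lam N) h hpos hs
      (fun s => by simpa only [hT] using he s)
    by_contra! hc
    have : ∑' η : ℤ, (η : ℝ)^2 * π η = 0 := by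
      rw [← tsum_zero (α := ℝ) (β := ℤ)]
      refine tsum_congr fun η => ?_
      by_cases h0 : η = 0
      · simp [h0]
      · simp [hc η h0]
    linarith
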